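/- arXiv:1403.2585 — 2 statements merged into one kernel-verified Lean document; each statement's English description precedes it below -/
import Mathlib

section
/- Let X and Y be Polish spaces and let μ be a Borel probability measure on X and ν a Borel probability measure on Y. Let (c_n) be a nondecreasing sequence of bounded continuous functions c_n : X × Y → [0,∞) converging pointwise to a function c : X × Y → [0,∞]. Then lim_{n→∞} inf_{π ∈ Π(μ,ν)} ∫_{X×Y} c_n(x,y) dπ(x,y) = inf_{π ∈ Π(μ,ν)} ∫_{X×Y} c(x,y) dπ(x,y). -/
open MeasureTheory ENNReal Filter

/-- `π` is a coupling of `μ` and `ν`: a measure on the product space with marginals `μ` and `ν`. -/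
def IsCoupling {X Y : Type*} [MeasurableSpace X] [MeasurableSpace Y]
    (π : Measure (X × Y)) (μ : Measure X) (ν : Measure Y) : Prop :=
  π.map Prod.fst = μ ∧ π.map Prod.snd = ν

/-- A coupling of probability measures is a probability measure. -/
theorem IsCoupling.isProbabilityMeasure {X Y : Type*} [MeasurableSpace X] [MeasurableSpace Y]
    {π : Measure (X × Y)} {μ : Measure X} {ν : Measure Y} [IsProbabilityMeasure μ]
    (h : IsCoupling π μ ν) : IsProbabilityMeasure π := by
  have : IsProbabilityMeasure (π.map Prod.fst) := h.1 ▸ inferInstance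
  exact Measure.isProbabilityMeasure_of_map Prod.fst

/-- The product measure is a coupling. -/
theorem isCoupling_prod {X Y : Type*} [MeasurableSpace X] [MeasurableSpace Y]
    (μ : Measure X) (ν : Measure Y) [IsProbabilityMeasure μ] [IsProbabilityMeasure ν] :
    IsCoupling (μ.prod ν) μ ν :=
  ⟨by simp [Measure.map_fst_prod], by simp [Measure.map_snd_prod]⟩

/-- The set of couplings of two Borel probability measures on Polish spaces is weakly compact. -/
theorem isCompact_setOf_isCoupling
    {X Y : Type*} [TopologicalSpace X] [PolishSpace X] [MeasurableSpace X] [BorelSpace X]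
    [TopologicalSpace Y] [PolishSpace Y] [MeasurableSpace Y] [BorelSpace Y]
    (μ : Measure X) (ν : Measure Y) [IsProbabilityMeasure μ] [IsProbabilityMeasure ν] :
    IsCompact {π : ProbabilityMeasure (X × Y) | IsCoupling (π : Measure (X × Y)) μ ν} := by
  set S := {π : ProbabilityMeasure (X × Y) | IsCoupling (π : Measure (X × Y)) μ ν}
  have hclosed : IsClosed S := by
    have hS' : S = {π | π.map measurable_fst.aemeasurable = ⟨μ, inferInstance⟩} ∩
        {π | π.map measurable_snd.aemeasurable = ⟨ν, inferInstance⟩} := by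
      ext π
      simp only [S, Set.mem_inter_iff, Set.mem_ofPred_eq]
      exact ⟨fun h => ⟨Subtype.ext h.1, Subtype.ext h.2⟩,
        fun h => ⟨congrArg Subtype.val h.1, congrArg Subtype.val h.2⟩⟩
    rw [hS']
    exact (isClosed_eq (ProbabilityMeasure.continuous_map continuous_fst)
        continuous_const).inter
      (isClosed_eq (ProbabilityMeasure.continuous_map continuous_snd) continuous_const)
  have htight : IsTightMeasureSet {((π : ProbabilityMeasure (X × Y)) : Measure (X × Y)) | π ∈ S} := by
    apply IsTightMeasureSet.prodMk
    · refine (isTightMeasureSet_singleton (μ := μ)).subset ?_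
      rintro _ ⟨_, ⟨π, hπ, rfl⟩, rfl⟩
      exact hπ.1
    · refine (isTightMeasureSet_singleton (μ := ν)).subset ?_
      rintro _ ⟨_, ⟨π, hπ, rfl⟩, rfl⟩
      exact hπ.2
  simpa only [hclosed.closure_eq] using isCompact_closure_of_isTightMeasureSet htight

/-- Integration of a bounded continuous function is weakly continuous. -/
theorem continuous_lintegral_probabilityMeasure {Z : Type*} [TopologicalSpace Z]
    [MeasurableSpace Z] [OpensMeasurableSpace Z] {f : Z → ℝ≥0∞} (hf : Continuous f)
    {M : ℝ≥0∞} (hM : M ≠ ∞) (hfM : ∀ z, f z ≤ M) :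
    Continuous fun π : ProbabilityMeasure Z => ∫⁻ z, f z ∂(π : Measure Z) := by
  have hfin : ∀ z, f z ≠ ∞ := fun z => ne_top_of_le_ne_top hM (hfM z)
  have hg : Continuous fun z => (f z).toNNReal :=
    ENNReal.continuousOn_toNNReal.comp_continuous hf hfin
  let g : BoundedContinuousFunction Z NNReal :=
    BoundedContinuousFunction.mkOfBound ⟨_, hg⟩ M.toNNReal fun x y => by
      have hb (z : Z) : (f z).toNNReal ≤ M.toNNReal := ENNReal.toNNReal_mono hM (hfM z)
      rw [NNReal.dist_eq, abs_le]
      have hx : ((f x).toNNReal : ℝ) ≤ M.toNNReal := hb x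
      have hy : ((f y).toNNReal : ℝ) ≤ M.toNNReal := hb y
      have hx0 := (f x).toNNReal.coe_nonneg
      have hy0 := (f y).toNNReal.coe_nonneg
      constructor <;> simp only [ContinuousMap.coe_mk] <;> linarith
  have hfg : ∀ z, f z = g z := fun z => (ENNReal.coe_toNNReal (hfin z)).symm
  simp only [hfg, continuous_iff_continuousAt, ContinuousAt]
  exact fun π => ProbabilityMeasure.tendsto_iff_forall_lintegral_tendsto.1 tendsto_id g

/-- A monotone sequence of continuous functions on a nonempty compact set is simultaneously
bounded, at some point of the set, by the supremum of its infima. -/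
theorem IsCompact.exists_forall_le_iSup_iInf {Z α : Type*} [TopologicalSpace Z] {K : Set Z}
    [CompleteLinearOrder α] [TopologicalSpace α] [OrderTopology α]
    (hK : IsCompact K) (hne : K.Nonempty) (hKc : IsClosed K) {F : ℕ → Z → α}
    (hF : ∀ n, Continuous (F n)) (hmono : Monotone F) :
    ∃ x ∈ K, ∀ n, F n x ≤ ⨆ n, ⨅ y ∈ K, F n y := by
  set L := ⨆ n, ⨅ y ∈ K, F n y
  have hclosed : ∀ n, IsClosed (K ∩ {x | F n x ≤ L}) := fun n =>
    hKc.inter (isClosed_le (hF n) continuous_const)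
  obtain ⟨x, hx⟩ := IsCompact.nonempty_iInter_of_sequence_nonempty_isCompact_isClosed
    (fun n => K ∩ {x | F n x ≤ L})
    (fun n x hx => ⟨hx.1, (hmono n.le_succ x).trans hx.2⟩)
    (fun n => by
      obtain ⟨x, hxK, hx⟩ := hK.exists_isMinOn hne (hF n).continuousOn
      exact ⟨x, hxK, le_iSup_of_le n (le_iInf₂ fun y hy => hx hy)⟩)
    (hK.inter_right (isClosed_le (hF 0) continuous_const)) hclosed
  rw [Set.mem_iInter] at hx
  exact ⟨x, (hx 0).1, fun n => (hx n).2⟩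

/-- Let `X` and `Y` be Polish spaces, `μ`, `ν` Borel probability measures on `X` resp. `Y`.
If `(cₙ)` is a nondecreasing sequence of bounded continuous cost functions converging
pointwise to `c`, then the optimal transport costs for `cₙ` converge to the optimal
transport cost for `c`. -/
theorem approx_cost_functions
    {X Y : Type*} [TopologicalSpace X] [PolishSpace X] [MeasurableSpace X] [BorelSpace X]
    [TopologicalSpace Y] [PolishSpace Y] [MeasurableSpace Y] [BorelSpace Y]
    (μ : Measure X) (ν : Measure Y) [IsProbabilityMeasure μ] [IsProbabilityMeasure ν]
    (cn : ℕ → X × Y → ℝ≥0∞) (c : X × Y → ℝ≥0∞)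
    (hcont : ∀ n, Continuous (cn n))
    (hbdd : ∀ n, ∃ M : ℝ≥0∞, M ≠ ∞ ∧ ∀ z, cn n z ≤ M)
    (hmono : Monotone cn)
    (hlim : ∀ z, Tendsto (fun n => cn n z) atTop (nhds (c z))) :
    Tendsto
      (fun n => ⨅ (π : Measure (X × Y)) (_ : IsCoupling π μ ν), ∫⁻ z, cn n z ∂π)
      atTop
      (nhds (⨅ (π : Measure (X × Y)) (_ : IsCoupling π μ ν), ∫⁻ z, c z ∂π)) := by
  have hsup : ∀ z, ⨆ n, cn n z = c z := fun z =>
    tendsto_nhds_unique (tendsto_atTop_iSup fun _ _ h => hmono h z) (hlim z)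
  have hint (π : Measure (X × Y)) : ∫⁻ z, c z ∂π = ⨆ n, ∫⁻ z, cn n z ∂π := by
    simp only [← hsup]
    exact lintegral_iSup (fun n => (hcont n).measurable) hmono
  have hmono' : Monotone fun n =>
      ⨅ (π : Measure (X × Y)) (_ : IsCoupling π μ ν), ∫⁻ z, cn n z ∂π :=
    fun _ _ h => iInf₂_mono fun _ _ => lintegral_mono (hmono h)
  suffices h : ⨅ (π : Measure (X × Y)) (_ : IsCoupling π μ ν), ∫⁻ z, c z ∂π =
      ⨆ n, ⨅ (π : Measure (X × Y)) (_ : IsCoupling π μ ν), ∫⁻ z, cn n z ∂π by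
    rw [h]
    exact tendsto_atTop_iSup hmono'
  apply le_antisymm
  · have hK := isCompact_setOf_isCoupling μ ν
    obtain ⟨π, hπ, hle⟩ := hK.exists_forall_le_iSup_iInf
      ⟨⟨μ.prod ν, inferInstance⟩, isCoupling_prod μ ν⟩ hK.isClosed
      (F := fun n π => ∫⁻ z, cn n z ∂(π : Measure (X × Y)))
      (fun n => by
        obtain ⟨M, hM, hle⟩ := hbdd n
        exact continuous_lintegral_probabilityMeasure (hcont n) hM hle)
      (fun _ _ h _ => lintegral_mono (hmono h))
    refine (iInf₂_le (π : Measure (X × Y)) hπ).trans ?_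
    rw [hint]
    refine iSup_le fun n => (hle n).trans (iSup_mono fun m => le_iInf₂ fun ρ hρ => ?_)
    exact iInf₂_le (⟨ρ, hρ.isProbabilityMeasure⟩ : ProbabilityMeasure (X × Y)) hρ
  · refine iSup_le fun n => iInf₂_mono fun π _ => ?_
    rw [hint]
    exact le_iSup (fun n => ∫⁻ z, cn n z ∂π) n
end

section
/- Let T > 0, let b : ℝ^d → ℝ^d be Lipschitz continuous with Lipschitz constant L > 0, and let ξ ∈ ℝ^d. Let x : [0,T] → ℝ^d be continuous with x(0) = 0 and let h : [0,T] → ℝ^d be continuous with h(0) = 0 and finite q-variation for some q ≥ 1. Let y and y_h be the continuous functions on [0,T] satisfying the integral equations y(t) = ξ + x(t) + ∫₀ᵗ b(y(s)) ds and y_h(t) = ξ + x(t) + h(t) + ∫₀ᵗ b(y_h(s)) ds. Then ‖y_h − y‖_{q-var;[0,T]} ≤ e^{LT} ‖h‖_{q-var;[0,T]}. -/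
open MeasureTheory ENNReal NNReal intervalIntegral

/-- The `q`-variation (with values in `[0,∞]`) of a path `z` over the interval `[S,T]`:
the supremum over all finite partitions `S = t₀ ≤ t₁ ≤ … ≤ t_n = T` of
`(∑ i, ‖z(t_{i+1}) - z(t_i)‖^q)^(1/q)`. -/
noncomputable def eVariation {E : Type*} [NormedAddCommGroup E]
    (q : ℝ) (z : ℝ → E) (S T : ℝ) : ℝ≥0∞ :=
  ⨆ (n : ℕ) (t : Fin (n + 1) → ℝ) (_ : Monotone t) (_ : t 0 = S)
      (_ : t (Fin.last n) = T),
    (∑ i : Fin n, ENNReal.ofReal ‖z (t i.succ) - z (t i.castSucc)‖ ^ q) ^ (1 / q)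

/-- A single increment is dominated by the `q`-variation. -/
theorem ofReal_norm_sub_le_eVariation {E : Type*} [NormedAddCommGroup E] {q : ℝ} (hq : 0 < q)
    (z : ℝ → E) {S T u : ℝ} (hSu : S ≤ u) (huT : u ≤ T) :
    ENNReal.ofReal ‖z u - z S‖ ≤ eVariation q z S T := by
  have hmono : Monotone ![S, u, T] := by
    rw [Fin.monotone_iff_le_succ]
    intro i
    fin_cases i
    · exact hSu
    · exact huT
  have key := le_iSup_of_le (f := fun n : ℕ => ⨆ (t : Fin (n + 1) → ℝ) (_ : Monotone t)
    (_ : t 0 = S) (_ : t (Fin.last n) = T),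
    (∑ i : Fin n, ENNReal.ofReal ‖z (t i.succ) - z (t i.castSucc)‖ ^ q) ^ (1 / q)) 2
    (le_iSup_of_le ![S, u, T] (le_iSup_of_le hmono (le_iSup_of_le rfl (le_iSup_of_le rfl le_rfl))))
  refine le_trans ?_ key
  have h0 : ENNReal.ofReal ‖z u - z S‖ ^ q ≤ ∑ i : Fin 2, ENNReal.ofReal
      ‖z (![S, u, T] i.succ) - z (![S, u, T] i.castSucc)‖ ^ q := by
    rw [Fin.sum_univ_two]
    exact le_self_add
  calc ENNReal.ofReal ‖z u - z S‖ = (ENNReal.ofReal ‖z u - z S‖ ^ q) ^ (1 / q) := by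
        rw [← ENNReal.rpow_mul, mul_one_div_cancel hq.ne', ENNReal.rpow_one]
    _ ≤ _ := ENNReal.rpow_le_rpow h0 (by positivity)

/-- The `ℓ^q` norm is dominated by the `ℓ^1` norm. -/
theorem ENNReal.sum_rpow_one_div_le_sum {ι : Type*} (s : Finset ι) (f : ι → ℝ≥0∞) {q : ℝ}
    (hq : 1 ≤ q) : (∑ i ∈ s, f i ^ q) ^ (1 / q) ≤ ∑ i ∈ s, f i := by
  have hq0 : 0 < q := by linarith
  classical
  induction s using Finset.induction_on with
  | empty => simp [hq0]
  | insert a s ha ih =>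
    rw [Finset.sum_insert ha, Finset.sum_insert ha]
    refine (ENNReal.rpow_add_le_add_rpow _ _ (by positivity)
      ((div_le_one hq0).2 hq)).trans (add_le_add ?_ ih)
    rw [← ENNReal.rpow_mul, mul_one_div_cancel hq0.ne', ENNReal.rpow_one]

theorem Fin.sum_succ_sub_castSucc {M : Type*} [AddCommGroup M] {n : ℕ} (f : Fin (n + 1) → M) :
    ∑ i : Fin n, (f i.succ - f i.castSucc) = f (Fin.last n) - f 0 := by
  rw [Finset.sum_sub_distrib, sub_eq_sub_iff_add_eq_add, add_comm, ← Fin.sum_univ_succ,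
    Fin.sum_univ_castSucc, add_comm]

/-- If the increments of `z` are dominated by those of `h` plus those of a monotone function `G`,
then the `q`-variation of `z` is at most that of `h` plus the total increment of `G`. -/
theorem eVariation_le_add_of_norm_sub_le {E F : Type*} [NormedAddCommGroup E]
    [NormedAddCommGroup F] {q : ℝ} (hq : 1 ≤ q) {z : ℝ → E} {h : ℝ → F} {G : ℝ → ℝ} {S T : ℝ}
    (hG : MonotoneOn G (Set.Icc S T))
    (hz : ∀ s t, S ≤ s → s ≤ t → t ≤ T → ‖z t - z s‖ ≤ ‖h t - h s‖ + (G t - G s)) :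
    eVariation q z S T ≤ eVariation q h S T + ENNReal.ofReal (G T - G S) := by
  refine iSup_le fun n => iSup_le fun t => iSup_le fun ht => iSup_le fun ht0 => iSup_le fun htn => ?_
  have hmem (i : Fin (n + 1)) : t i ∈ Set.Icc S T :=
    ⟨ht0 ▸ ht (Fin.zero_le i), htn ▸ ht (Fin.le_last i)⟩
  have hstep (i : Fin n) : t i.castSucc ≤ t i.succ := ht (Fin.castSucc_le_succ i)
  have hinc (i : Fin n) : 0 ≤ G (t i.succ) - G (t i.castSucc) :=
    sub_nonneg.2 (hG (hmem _) (hmem _) (hstep i))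
  calc (∑ i : Fin n, ENNReal.ofReal ‖z (t i.succ) - z (t i.castSucc)‖ ^ q) ^ (1 / q)
      ≤ (∑ i : Fin n, (ENNReal.ofReal ‖h (t i.succ) - h (t i.castSucc)‖ +
          ENNReal.ofReal (G (t i.succ) - G (t i.castSucc))) ^ q) ^ (1 / q) := by
        gcongr with i
        rw [← ENNReal.ofReal_add (norm_nonneg _) (hinc i)]
        exact ENNReal.ofReal_le_ofReal (hz _ _ (hmem _).1 (hstep i) (hmem _).2)
    _ ≤ (∑ i : Fin n, ENNReal.ofReal ‖h (t i.succ) - h (t i.castSucc)‖ ^ q) ^ (1 / q) +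
          (∑ i : Fin n, ENNReal.ofReal (G (t i.succ) - G (t i.castSucc)) ^ q) ^ (1 / q) :=
        ENNReal.Lp_add_le _ _ _ hq
    _ ≤ eVariation q h S T + ENNReal.ofReal (G T - G S) := by
        refine add_le_add (le_iSup_of_le n (le_iSup_of_le t (le_iSup_of_le ht
          (le_iSup_of_le ht0 (le_iSup_of_le htn le_rfl))))) ?_
        refine (ENNReal.sum_rpow_one_div_le_sum _ _ hq).trans_eq ?_
        rw [← ENNReal.ofReal_sum_of_nonneg fun i _ => hinc i,
          Fin.sum_succ_sub_castSucc fun i => G (t i), ht0, htn]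

/-- Integral form of Grönwall's inequality with constant coefficients. -/
theorem mul_integral_le_of_le_add_mul_integral {φ : ℝ → ℝ} (hφ : Continuous φ)
    (hφ0 : ∀ t, 0 ≤ φ t) {T L H : ℝ} (hT : 0 ≤ T) (hL : 0 < L)
    (hle : ∀ t ∈ Set.Icc 0 T, φ t ≤ H + L * ∫ s in (0 : ℝ)..t, φ s) :
    L * ∫ s in (0 : ℝ)..T, φ s ≤ H * (Real.exp (L * T) - 1) := by
  have hderiv (t : ℝ) : HasDerivAt (fun t => ∫ s in (0 : ℝ)..t, φ s) (φ t) t :=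
    hφ.integral_hasStrictDerivAt 0 t |>.hasDerivAt
  have hgr := norm_le_gronwallBound_of_norm_deriv_right_le (f := fun t => ∫ s in (0 : ℝ)..t, φ s)
    (f' := φ) (δ := 0) (K := L) (ε := H) (a := 0) (b := T)
    (fun t _ => (hderiv t).continuousAt.continuousWithinAt)
    (fun t _ => (hderiv t).hasDerivWithinAt) (by simp) (fun t ht => by
      rw [Real.norm_of_nonneg (hφ0 t), Real.norm_of_nonneg
        (intervalIntegral.integral_nonneg ht.1 fun s _ => hφ0 s), add_comm]
      exact hle t ⟨ht.1, ht.2.le⟩) T ⟨hT, le_rfl⟩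
  simp only [gronwallBound_of_K_ne_0 hL.ne', sub_zero, zero_mul, zero_add] at hgr
  calc L * ∫ s in (0 : ℝ)..T, φ s ≤ L * (H / L * (Real.exp (L * T) - 1)) := by
        gcongr
        exact (le_abs_self _).trans hgr
    _ = H * (Real.exp (L * T) - 1) := by field_simp

/-- Additive noise: if `y` solves `y(t) = ξ + x(t) + ∫₀ᵗ b(y(s)) ds` and `y_h` solves the same
equation with `x` replaced by `x + h`, where `b` is `L`-Lipschitz, then
`‖y_h - y‖_{q-var;[0,T]} ≤ e^{LT} ‖h‖_{q-var;[0,T]}`. -/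
theorem qvar_estimate_additive_noise
    {d : ℕ} (T : ℝ) (hT : 0 < T) (L : ℝ≥0) (hL : 0 < L)
    (b : EuclideanSpace ℝ (Fin d) → EuclideanSpace ℝ (Fin d)) (hb : LipschitzWith L b)
    (ξ : EuclideanSpace ℝ (Fin d)) (q : ℝ) (hq : 1 ≤ q)
    (x h : ℝ → EuclideanSpace ℝ (Fin d))
    (hx : ContinuousOn x (Set.Icc 0 T)) (hx0 : x 0 = 0)
    (hh : ContinuousOn h (Set.Icc 0 T)) (hh0 : h 0 = 0)
    (hhfin : eVariation q h 0 T ≠ ∞)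
    (y yh : ℝ → EuclideanSpace ℝ (Fin d))
    (hy : ContinuousOn y (Set.Icc 0 T)) (hyh : ContinuousOn yh (Set.Icc 0 T))
    (hyeq : ∀ t ∈ Set.Icc (0 : ℝ) T, y t = ξ + x t + ∫ s in (0 : ℝ)..t, b (y s))
    (hyheq : ∀ t ∈ Set.Icc (0 : ℝ) T, yh t = ξ + x t + h t + ∫ s in (0 : ℝ)..t, b (yh s)) :
    eVariation q (fun t => yh t - y t) 0 T ≤
      ENNReal.ofReal (Real.exp ((L : ℝ) * T)) * eVariation q h 0 T := by
  have hq0 : 0 < q := by linarith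
  set z : ℝ → EuclideanSpace ℝ (Fin d) := fun t => yh t - y t with hz
  have hzc : ContinuousOn (fun t => ‖z t‖) (Set.Icc 0 T) := (hyh.sub hy).norm
  set φ : ℝ → ℝ := Set.IccExtend hT.le (Set.domRestrict (Set.Icc 0 T) fun t => ‖z t‖)
  have hφ : Continuous φ := hzc.domRestrict.Icc_extend'
  have hφz (t : ℝ) (ht : t ∈ Set.Icc 0 T) : φ t = ‖z t‖ := Set.IccExtend_of_mem _ _ ht
  have hφ0 (t : ℝ) : 0 ≤ φ t := norm_nonneg _
  have hby (w : ℝ → EuclideanSpace ℝ (Fin d)) (hw : ContinuousOn w (Set.Icc 0 T)) (s t : ℝ)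
      (hs : 0 ≤ s) (hst : s ≤ t) (ht : t ≤ T) :
      IntervalIntegrable (fun u => b (w u)) volume s t := by
    refine ContinuousOn.intervalIntegrable_of_Icc hst ?_
    exact (hb.continuous.comp_continuousOn hw).mono (Set.Icc_subset_Icc hs ht)
  have hinc (s t : ℝ) (hs : 0 ≤ s) (hst : s ≤ t) (ht : t ≤ T) : ‖z t - z s‖ ≤ ‖h t - h s‖ +
      ((L : ℝ) * (∫ u in (0 : ℝ)..t, φ u) - (L : ℝ) * ∫ u in (0 : ℝ)..s, φ u) := by
    have hsT : s ≤ T := hst.trans ht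
    have heq : z t - z s = (h t - h s) + ∫ u in s..t, (b (yh u) - b (y u)) := by
      rw [intervalIntegral.integral_sub (hby yh hyh s t hs hst ht) (hby y hy s t hs hst ht),
        ← intervalIntegral.integral_interval_sub_left (hby yh hyh 0 t le_rfl (hs.trans hst) ht)
          (hby yh hyh 0 s le_rfl hs hsT),
        ← intervalIntegral.integral_interval_sub_left (hby y hy 0 t le_rfl (hs.trans hst) ht)
          (hby y hy 0 s le_rfl hs hsT)]
      simp only [hz]
      rw [hyheq t ⟨hs.trans hst, ht⟩, hyheq s ⟨hs, hsT⟩, hyeq t ⟨hs.trans hst, ht⟩,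
        hyeq s ⟨hs, hsT⟩]
      abel
    rw [heq, ← mul_sub, intervalIntegral.integral_interval_sub_left
      (hφ.intervalIntegrable _ _) (hφ.intervalIntegrable _ _),
      ← intervalIntegral.integral_const_mul]
    refine (norm_add_le _ _).trans (add_le_add le_rfl ?_)
    refine intervalIntegral.norm_integral_le_of_norm_le hst (ae_of_all _ fun u hu => ?_)
      ((hφ.const_mul _).intervalIntegrable _ _)
    rw [hφz u ⟨hs.trans hu.1.le, hu.2.trans ht⟩]
    exact hb.norm_sub_le _ _
  have hz0 : z 0 = 0 := by
    simp [hz, hyheq 0 ⟨le_rfl, hT.le⟩, hyeq 0 ⟨le_rfl, hT.le⟩, hh0]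
  have hgron := mul_integral_le_of_le_add_mul_integral hφ hφ0 hT.le (L := L)
    (H := (eVariation q h 0 T).toReal) (by exact_mod_cast hL) (fun t ht => by
      have h1 := hinc 0 t le_rfl ht.1 ht.2
      have h2 := (ENNReal.ofReal_le_iff_le_toReal hhfin).1
        (ofReal_norm_sub_le_eVariation hq0 h ht.1 ht.2)
      rw [hz0, sub_zero, intervalIntegral.integral_same, mul_zero, sub_zero] at h1
      rw [hφz t ht]
      linarith)
  have hG : MonotoneOn (fun t => (L : ℝ) * ∫ u in (0 : ℝ)..t, φ u) (Set.Icc 0 T) := by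
    intro s _ t _ hst
    refine mul_le_mul_of_nonneg_left ?_ L.coe_nonneg
    rw [← sub_nonneg, intervalIntegral.integral_interval_sub_left
      (hφ.intervalIntegrable _ _) (hφ.intervalIntegrable _ _)]
    exact intervalIntegral.integral_nonneg hst fun u _ => hφ0 u
  refine (eVariation_le_add_of_norm_sub_le hq hG hinc).trans ?_
  rw [intervalIntegral.integral_same, mul_zero, sub_zero]
  have hexp : 0 ≤ Real.exp ((L : ℝ) * T) - 1 :=
    sub_nonneg.2 (Real.one_le_exp (mul_nonneg L.coe_nonneg hT.le))
  calc eVariation q h 0 T + ENNReal.ofReal ((L : ℝ) * ∫ u in (0 : ℝ)..T, φ u)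
      ≤ ENNReal.ofReal (eVariation q h 0 T).toReal +
        ENNReal.ofReal ((eVariation q h 0 T).toReal * (Real.exp ((L : ℝ) * T) - 1)) := by
        rw [ENNReal.ofReal_toReal hhfin]
        gcongr
    _ = ENNReal.ofReal (Real.exp ((L : ℝ) * T) * (eVariation q h 0 T).toReal) := by
        rw [← ENNReal.ofReal_add ENNReal.toReal_nonneg (mul_nonneg ENNReal.toReal_nonneg hexp)]
        ring_nf
    _ = ENNReal.ofReal (Real.exp ((L : ℝ) * T)) * eVariation q h 0 T := by
        rw [ENNReal.ofReal_mul (Real.exp_pos _).le, ENNReal.ofReal_toReal hhfin]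
end
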